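/- Assume Σ_{x∈ℤ}(|α(x)−α₀| + |θ(x)|) < ∞. Then for every ξ ∈ ℝ with sin ξ ≠ 0 there exist Jost solutions φ₊(·,ξ) and φ₋(·,ξ), and moreover there is an increasing function c : (0,∞) → (0,∞), independent of ξ, such that sup_{x∈ℤ} ‖e^{∓iξx}φ±(x,ξ)‖ ≤ c(|sin ξ|⁻¹). If moreover Σ_{x∈ℤ}⟨x⟩(|α(x)−α₀| + |θ(x)|) < ∞, then Jost solutions φ±(·,ξ) exist for every ξ ∈ ℝ (including sin ξ = 0), and there is a constant C, independent of x and ξ, with ‖e^{∓iξx}φ±(x,ξ)‖ ≤ C·max(1, ∓x) for all x ∈ ℤ. -/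

import Mathlib

open Complex Matrix

noncomputable section

/-- The coin matrix `C_{α,β,θ} = e^{iθ}[[β, conj α],[−α, conj β]]`. -/
def coinMat (a b : ℂ) (t : ℝ) : Matrix (Fin 2) (Fin 2) ℂ :=
  Complex.exp ((t : ℂ) * Complex.I) • !![b, (starRingEnd ℂ) a; -a, (starRingEnd ℂ) b]

/-- The quantum walk evolution operator `U = SĈ`, acting on arbitrary `u : ℤ → ℂ²`:
`(Uu)↑(x) = (C(x−1)u(x−1))↑`, `(Uu)↓(x) = (C(x+1)u(x+1))↓`. -/
def qw (C : ℤ → Matrix (Fin 2) (Fin 2) ℂ) (u : ℤ → Fin 2 → ℂ) : ℤ → Fin 2 → ℂ :=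
  fun x => ![(C (x - 1)).mulVec (u (x - 1)) 0, (C (x + 1)).mulVec (u (x + 1)) 1]

/-- `ρ = √(1−|a|²)`. -/
def rho (a : ℂ) : ℝ := Real.sqrt (1 - ‖a‖ ^ 2)

/-- The coin map `x ↦ C_{α(x), ρ(x), θ(x)}`. -/
def coinOf (α : ℤ → ℂ) (θ : ℤ → ℝ) : ℤ → Matrix (Fin 2) (Fin 2) ℂ :=
  fun x => coinMat (α x) ((rho (α x) : ℝ) : ℂ) (θ x)

/-- The transfer matrix `T_λ(x)`. -/
def Tmat (α : ℤ → ℂ) (θ : ℤ → ℝ) (lam : ℂ) (x : ℤ) : Matrix (Fin 2) (Fin 2) ℂ :=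
  (((rho (α x) : ℝ) : ℂ))⁻¹ •
    !![Complex.exp (Complex.I * (lam - (θ x : ℂ))), α x;
       (starRingEnd ℂ) (α x), Complex.exp (-(Complex.I * (lam - (θ x : ℂ))))]

/-- `(J_VE u)(x) = (u↓(x−1), u↑(x))`. -/
def Jve (u : ℤ → Fin 2 → ℂ) : ℤ → Fin 2 → ℂ := fun x => ![u (x - 1) 1, u x 0]

/-- `(J_EV v)(x) = (v↓(x), v↑(x+1))`, the inverse of `J_VE`. -/
def Jev (v : ℤ → Fin 2 → ℂ) : ℤ → Fin 2 → ℂ := fun x => ![v x 1, v (x + 1) 0]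

/-- Determinant of the 2×2 matrix with columns `v, w`. -/
def det2 (v w : Fin 2 → ℂ) : ℂ := v 0 * w 1 - v 1 * w 0

/-- The Euclidean norm on ℂ². -/
def nrm2 (v : Fin 2 → ℂ) : ℝ := Real.sqrt (‖v 0‖ ^ 2 + ‖v 1‖ ^ 2)

/-- Membership in `l²(ℤ, ℂ²)`. -/
def MemL2 (u : ℤ → Fin 2 → ℂ) : Prop := Summable fun x : ℤ => ‖u x 0‖ ^ 2 + ‖u x 1‖ ^ 2

/-- The Japanese bracket `⟨x⟩ = √(1+x²)`. -/
def jp (x : ℤ) : ℝ := Real.sqrt (1 + (x : ℝ) ^ 2)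

/-- The free transfer matrix `T_{0,λ}` (for real `λ`). -/
def T0m (a0 : ℂ) (lam : ℝ) : Matrix (Fin 2) (Fin 2) ℂ :=
  (((rho a0 : ℝ) : ℂ))⁻¹ •
    !![Complex.exp (Complex.I * (lam : ℂ)), a0;
       (starRingEnd ℂ) a0, Complex.exp (-(Complex.I * (lam : ℂ)))]

/-- `λ(ξ) = arccos(ρ₀ cos ξ) ∈ [0,π]`. -/
def lamOf (a0 : ℂ) (ξ : ℝ) : ℝ := Real.arccos (rho a0 * Real.cos ξ)

/-- `A_{ξ,±} = e^{∓iξ}T_{0,λ(ξ)}`; `ε = 1` is the `+` case, `ε = −1` the `−` case. -/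
def Amat (a0 : ℂ) (ε : ℝ) (ξ : ℝ) : Matrix (Fin 2) (Fin 2) ℂ :=
  Complex.exp (-(((ε * ξ : ℝ) : ℂ) * Complex.I)) • T0m a0 (lamOf a0 ξ)

/-- Integer powers of a matrix: for negative exponents, powers of the inverse matrix. -/
def mzpow (A : Matrix (Fin 2) (Fin 2) ℂ) (x : ℤ) : Matrix (Fin 2) (Fin 2) ℂ :=
  if 0 ≤ x then A ^ x.toNat else A⁻¹ ^ (-x).toNat

/-- The operator norm on `ℂ²` of a 2×2 matrix. -/
def opN (A : Matrix (Fin 2) (Fin 2) ℂ) : ℝ := ‖Matrix.toEuclideanCLM (𝕜 := ℂ) A‖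

/-- `A_±(ξ) = |α₀|² + |e^{iλ(ξ)} − ρ₀e^{±iξ}|²`; `ε = ±1`. -/
def Aco (a0 : ℂ) (ε : ℝ) (ξ : ℝ) : ℝ :=
  ‖a0‖ ^ 2 + ‖Complex.exp (Complex.I * (lamOf a0 ξ : ℂ))
      - ((rho a0 : ℝ) : ℂ) * Complex.exp (((ε * ξ : ℝ) : ℂ) * Complex.I)‖ ^ 2

/-- The unit eigenvector `φ_±(ξ) = A_±(ξ)^{−1/2}(−α₀, e^{iλ(ξ)} − ρ₀e^{±iξ})ᵀ`; `ε = ±1`. -/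
def jvec (a0 : ℂ) (ε : ℝ) (ξ : ℝ) : Fin 2 → ℂ :=
  (((Real.sqrt (Aco a0 ε ξ))⁻¹ : ℝ) : ℂ) •
    ![-a0, Complex.exp (Complex.I * (lamOf a0 ξ : ℂ))
        - ((rho a0 : ℝ) : ℂ) * Complex.exp (((ε * ξ : ℝ) : ℂ) * Complex.I)]

/-- `φ` is a Jost solution `φ₊(·,ξ)`: solves the transfer recursion at `λ(ξ)` and
`e^{−iξx}φ(x) → φ₊(ξ)` as `x → +∞`. -/
def IsJostP (α : ℤ → ℂ) (θ : ℤ → ℝ) (a0 : ℂ) (ξ : ℝ) (φ : ℤ → Fin 2 → ℂ) : Prop :=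
  (∀ x : ℤ, φ (x + 1) = (Tmat α θ ((lamOf a0 ξ : ℝ) : ℂ) x).mulVec (φ x)) ∧
  Filter.Tendsto
    (fun x : ℤ => fun i : Fin 2 => Complex.exp (-(((ξ * x : ℝ) : ℂ) * Complex.I)) * φ x i)
    Filter.atTop (nhds (jvec a0 1 ξ))

/-- `φ` is a Jost solution `φ₋(·,ξ)`: solves the transfer recursion at `λ(ξ)` and
`e^{iξx}φ(x) → φ₋(ξ)` as `x → −∞`. -/
def IsJostM (α : ℤ → ℂ) (θ : ℤ → ℝ) (a0 : ℂ) (ξ : ℝ) (φ : ℤ → Fin 2 → ℂ) : Prop :=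
  (∀ x : ℤ, φ (x + 1) = (Tmat α θ ((lamOf a0 ξ : ℝ) : ℂ) x).mulVec (φ x)) ∧
  Filter.Tendsto
    (fun x : ℤ => fun i : Fin 2 => Complex.exp (((ξ * x : ℝ) : ℂ) * Complex.I) * φ x i)
    Filter.atBot (nhds (jvec a0 (-1) ξ))

open Filter Topology

theorem le_mul_exp_sum_of_le_add_sum {g γ : ℕ → ℝ} {c : ℝ} (hγ : ∀ i, 0 ≤ γ i)
    (h : ∀ k, g k ≤ c + ∑ i ∈ Finset.range k, γ i * g i) (hc : 0 ≤ c) (k : ℕ) :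
    g k ≤ c * Real.exp (∑ i ∈ Finset.range k, γ i) := by
  refine (h k).trans ?_
  induction k with
  | zero => simp
  | succ k ih =>
    rw [Finset.sum_range_succ, Finset.sum_range_succ, Real.exp_add]
    calc c + (∑ i ∈ Finset.range k, γ i * g i + γ k * g k)
        ≤ (c * Real.exp (∑ i ∈ Finset.range k, γ i)) * (γ k + 1) := by
          nlinarith [mul_le_mul_of_nonneg_left ((h k).trans ih) (hγ k)]
      _ ≤ (c * Real.exp (∑ i ∈ Finset.range k, γ i)) * Real.exp (γ k) := by
          gcongr
          exact Real.add_one_le_exp _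
      _ = _ := by ring

/-- The sum of `γ` over the integers `≥ x`. -/
def tailSum (γ : ℤ → ℝ) (x : ℤ) : ℝ := ∑' j : ℕ, γ (x + j)

section tailSum

variable {γ : ℤ → ℝ}

theorem add_natCast_injective (x : ℤ) : Function.Injective fun j : ℕ => x + (j : ℤ) :=
  fun _ _ h => by simpa using h

theorem tailSum_le_tsum (hγ0 : ∀ x, 0 ≤ γ x) (hγ : Summable γ) (x : ℤ) :
    tailSum γ x ≤ ∑' y, γ y :=
  tsum_comp_le_tsum_of_inj hγ hγ0 (add_natCast_injective x)

theorem sum_range_le_tailSum (hγ0 : ∀ x, 0 ≤ γ x) (hγ : Summable γ) (x : ℤ) (k : ℕ) :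
    ∑ i ∈ Finset.range k, γ (x + k - 1 - i) ≤ tailSum γ x := by
  rw [← Finset.sum_range_reflect]
  calc ∑ j ∈ Finset.range k, γ (x + k - 1 - (k - 1 - j : ℕ))
      = ∑ j ∈ Finset.range k, γ (x + j) := by
        refine Finset.sum_congr rfl fun j hj => ?_
        rw [Finset.mem_range] at hj
        congr 1
        omega
    _ ≤ _ := (hγ.comp_injective (add_natCast_injective x)).sum_le_tsum _ fun _ _ => hγ0 _

theorem tendsto_tailSum_atTop : Tendsto (tailSum γ) atTop (𝓝 0) := by
  rw [← Nat.map_cast_int_atTop, tendsto_map'_iff]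
  refine (_root_.tendsto_sum_nat_add fun j : ℕ => γ j).congr fun i => ?_
  simp only [tailSum, Function.comp_apply]
  congr 1
  ext j
  push_cast
  rw [add_comm]

end tailSum

section backward

variable {n : Type*} [Fintype n] [DecidableEq n]

/-- The solution of `v x = M x *ᵥ v (x + 1)` with `v N = v₀`, evaluated at `N - k`. -/
def backwardSol (M : ℤ → Matrix n n ℂ) (v₀ : n → ℂ) (N : ℤ) : ℕ → n → ℂ
  | 0 => v₀
  | k + 1 => M (N - 1 - k) *ᵥ backwardSol M v₀ N k

theorem backwardSol_eq_add_sum {D : Matrix n n ℂ} (M : ℤ → Matrix n n ℂ) {v₀ : n → ℂ}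
    (hv : D *ᵥ v₀ = v₀) (N : ℤ) (k : ℕ) :
    backwardSol M v₀ N k = v₀ + ∑ i ∈ Finset.range k,
      D ^ (k - 1 - i) *ᵥ ((M (N - 1 - i) - D) *ᵥ backwardSol M v₀ N i) := by
  induction k with
  | zero => simp [backwardSol]
  | succ k ih =>
    have hsum : ∑ i ∈ Finset.range k,
        D ^ (k + 1 - 1 - i) *ᵥ ((M (N - 1 - i) - D) *ᵥ backwardSol M v₀ N i)
        = D *ᵥ ∑ i ∈ Finset.range k,
          D ^ (k - 1 - i) *ᵥ ((M (N - 1 - i) - D) *ᵥ backwardSol M v₀ N i) := by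
      rw [Matrix.mulVec_sum]
      refine Finset.sum_congr rfl fun i hi => ?_
      rw [Finset.mem_range] at hi
      rw [Matrix.mulVec_mulVec _ D, ← pow_succ', show k - 1 - i + 1 = k + 1 - 1 - i by omega]
    rw [Finset.sum_range_succ, hsum]
    have hD := congrArg (D *ᵥ ·) ih
    simp only [Matrix.mulVec_add, hv] at hD
    rw [← add_assoc, ← hD]
    simp [backwardSol, Matrix.sub_mulVec]

variable {D : Matrix n n ℂ} {M : ℤ → Matrix n n ℂ} {v₀ : n → ℂ} {m γ : ℤ → ℝ}

theorem norm_backwardSol_sub_le_sum (hv : D *ᵥ v₀ = v₀) (hm : ∀ x, 1 ≤ m x)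
    (h : ∀ (x : ℤ) (j : ℕ) (w : n → ℂ),
      ‖D ^ j *ᵥ ((M (x + j) - D) *ᵥ w)‖ * m (x + j + 1) ≤ m x * γ (x + j) * ‖w‖)
    (N : ℤ) (k : ℕ) :
    ‖backwardSol M v₀ N k - v₀‖ ≤ m (N - k) * ∑ i ∈ Finset.range k,
      γ (N - 1 - i) * (‖backwardSol M v₀ N i‖ / m (N - i)) := by
  rw [backwardSol_eq_add_sum M hv N k, add_sub_cancel_left, Finset.mul_sum]
  refine (norm_sum_le _ _).trans (Finset.sum_le_sum fun i hi => ?_)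
  rw [Finset.mem_range] at hi
  have hj := h (N - k) (k - 1 - i) (backwardSol M v₀ N i)
  rw [show N - (k : ℤ) + (k - 1 - i : ℕ) = N - 1 - i by omega,
    show N - 1 - (i : ℤ) + 1 = N - i by ring] at hj
  rw [← mul_div_assoc, ← mul_div_assoc, le_div_iff₀ (by linarith [hm (N - i)])]
  linarith

theorem norm_backwardSol_div_le (hv : D *ᵥ v₀ = v₀) (hm : ∀ x, 1 ≤ m x)
    (hγ0 : ∀ x, 0 ≤ γ x) (hγ : Summable γ)
    (h : ∀ (x : ℤ) (j : ℕ) (w : n → ℂ),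
      ‖D ^ j *ᵥ ((M (x + j) - D) *ᵥ w)‖ * m (x + j + 1) ≤ m x * γ (x + j) * ‖w‖)
    (N : ℤ) (k : ℕ) :
    ‖backwardSol M v₀ N k‖ / m (N - k) ≤ ‖v₀‖ * Real.exp (∑' y, γ y) := by
  have hm' : ∀ x, 0 < m x := fun x => one_pos.trans_le (hm x)
  have hk := le_mul_exp_sum_of_le_add_sum
    (g := fun k : ℕ => ‖backwardSol M v₀ N k‖ / m (N - k)) (γ := fun i : ℕ => γ (N - 1 - i))
    (c := ‖v₀‖) (fun i => hγ0 _) (fun k => ?_) (norm_nonneg _) k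
  · refine hk.trans ?_
    gcongr
    have := sum_range_le_tailSum hγ0 hγ (N - k) k
    rw [show N - (k : ℤ) + k - 1 = N - 1 by ring] at this
    exact this.trans (tailSum_le_tsum hγ0 hγ _)
  · rw [div_le_iff₀ (hm' _), add_mul, mul_comm (Finset.sum _ _)]
    have h1 := norm_backwardSol_sub_le_sum hv hm h N k
    have h2 := norm_le_norm_sub_add (backwardSol M v₀ N k) v₀
    have h3 := le_mul_of_one_le_right (norm_nonneg v₀) (hm (N - k))
    linarith

theorem norm_backwardSol_sub_le (hv : D *ᵥ v₀ = v₀) (hm : ∀ x, 1 ≤ m x)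
    (hγ0 : ∀ x, 0 ≤ γ x) (hγ : Summable γ)
    (h : ∀ (x : ℤ) (j : ℕ) (w : n → ℂ),
      ‖D ^ j *ᵥ ((M (x + j) - D) *ᵥ w)‖ * m (x + j + 1) ≤ m x * γ (x + j) * ‖w‖)
    (N : ℤ) (k : ℕ) :
    ‖backwardSol M v₀ N k - v₀‖
      ≤ m (N - k) * (tailSum γ (N - k) * (‖v₀‖ * Real.exp (∑' y, γ y))) := by
  refine (norm_backwardSol_sub_le_sum hv hm h N k).trans ?_
  have := sum_range_le_tailSum hγ0 hγ (N - k) k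
  rw [show N - (k : ℤ) + k - 1 = N - 1 by ring] at this
  refine mul_le_mul_of_nonneg_left ?_ (zero_le_one.trans (hm _))
  calc _ ≤ ∑ i ∈ Finset.range k, γ (N - 1 - i) * (‖v₀‖ * Real.exp (∑' y, γ y)) :=
        Finset.sum_le_sum fun i _ => mul_le_mul_of_nonneg_left
          (norm_backwardSol_div_le hv hm hγ0 hγ h N i) (hγ0 _)
    _ ≤ _ := by
        rw [← Finset.sum_mul]
        gcongr

/-- A backward recursion `v x = M x *ᵥ v (x + 1)` that is a weighted-summable perturbation of a
constant one has a solution converging at `+∞` to any prescribed fixed vector of the latter. -/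
theorem exists_tendsto_of_backward_recursion (hv : D *ᵥ v₀ = v₀) (hm : ∀ x, 1 ≤ m x)
    (hm1 : ∀ x, 0 ≤ x → m x = 1) (hγ0 : ∀ x, 0 ≤ γ x) (hγ : Summable γ)
    (h : ∀ (x : ℤ) (j : ℕ) (w : n → ℂ),
      ‖D ^ j *ᵥ ((M (x + j) - D) *ᵥ w)‖ * m (x + j + 1) ≤ m x * γ (x + j) * ‖w‖) :
    ∃ v : ℤ → n → ℂ, (∀ x, v x = M x *ᵥ v (x + 1)) ∧ Tendsto v atTop (𝓝 v₀) ∧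
      ∀ x, ‖v x‖ ≤ ‖v₀‖ * Real.exp (∑' y, γ y) * m x := by
  set G := ‖v₀‖ * Real.exp (∑' y, γ y)
  let V : ℤ → ℕ → n → ℂ := fun x N => backwardSol M v₀ N ((N : ℤ) - x).toNat
  have hcast : ∀ (x : ℤ), ∀ᶠ N : ℕ in (hyperfilter ℕ : Filter ℕ), x < N := fun x => by
    refine Nat.hyperfilter_le_atTop ?_
    filter_upwards [eventually_gt_atTop x.toNat] with N hN
    omega
  have hVM : ∀ x, ∀ᶠ N in (hyperfilter ℕ : Filter ℕ), V x N = M x *ᵥ V (x + 1) N := fun x => by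
    filter_upwards [hcast x] with N hN
    have : ((N : ℤ) - x).toNat = ((N : ℤ) - (x + 1)).toNat + 1 := by omega
    simp only [V, this, backwardSol]
    congr 2
    omega
  have hVb : ∀ x, ∀ᶠ N in (hyperfilter ℕ : Filter ℕ), ‖V x N‖ ≤ G * m x := fun x => by
    filter_upwards [hcast x] with N hN
    have := norm_backwardSol_div_le hv hm hγ0 hγ h N ((N : ℤ) - x).toNat
    rwa [show (N : ℤ) - ((N : ℤ) - x).toNat = x by omega,
      div_le_iff₀ (one_pos.trans_le (hm x))] at this
  have hVs : ∀ x, ∀ᶠ N in (hyperfilter ℕ : Filter ℕ),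
      ‖V x N - v₀‖ ≤ m x * (tailSum γ x * G) := fun x => by
    filter_upwards [hcast x] with N hN
    have := norm_backwardSol_sub_le hv hm hγ0 hγ h N ((N : ℤ) - x).toNat
    rwa [show (N : ℤ) - ((N : ℤ) - x).toNat = x by omega] at this
  have hlim : ∀ x, ∃ a, Tendsto (V x) (hyperfilter ℕ) (𝓝 a) := fun x => by
    obtain ⟨a, -, ha⟩ := (isCompact_closedBall (0 : n → ℂ) (G * m x)).ultrafilter_le_nhds'
      ((hyperfilter ℕ).map (V x))
      (Ultrafilter.mem_map.2 ((hVb x).mono fun N hN => by simpa using hN))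
    exact ⟨a, ha⟩
  choose v hv' using hlim
  refine ⟨v, fun x => ?_, ?_, fun x => le_of_tendsto (hv' x).norm (hVb x)⟩
  · have hcont : Continuous fun w : n → ℂ => M x *ᵥ w := by fun_prop
    exact tendsto_nhds_unique_of_eventuallyEq (hv' x)
      ((hcont.tendsto _).comp (hv' (x + 1))) (hVM x)
  · rw [tendsto_iff_norm_sub_tendsto_zero]
    refine squeeze_zero' (Eventually.of_forall fun _ => norm_nonneg _) ?_
      (by simpa using (tendsto_tailSum_atTop (γ := γ)).mul_const G)
    filter_upwards [eventually_ge_atTop 0] with x hx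
    simpa [hm1 x hx] using le_of_tendsto ((hv' x).sub_const v₀).norm (hVs x)

end backward

section transfer

theorem norm_mulVec_le_of_entry_le {A : Matrix (Fin 2) (Fin 2) ℂ} {c : ℝ}
    (h : ∀ i j, ‖A i j‖ ≤ c) (w : Fin 2 → ℂ) : ‖A *ᵥ w‖ ≤ 2 * c * ‖w‖ := by
  have hc : 0 ≤ c := (norm_nonneg _).trans (h 0 0)
  refine (pi_norm_le_iff_of_nonneg (by positivity)).2 fun i => ?_
  rw [Matrix.mulVec, dotProduct, Fin.sum_univ_two]
  calc _ ≤ ‖A i 0‖ * ‖w 0‖ + ‖A i 1‖ * ‖w 1‖ := by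
        simpa only [norm_mul] using norm_add_le (A i 0 * w 0) (A i 1 * w 1)
    _ ≤ c * ‖w‖ + c * ‖w‖ := by gcongr <;> first | exact h _ _ | exact norm_le_pi_norm w _
    _ = _ := by ring

theorem nrm2_le_sqrt_two_mul_norm (w : Fin 2 → ℂ) : nrm2 w ≤ √2 * ‖w‖ := by
  refine Real.sqrt_le_iff.2 ⟨by positivity, ?_⟩
  rw [mul_pow, Real.sq_sqrt zero_le_two, two_mul]
  gcongr <;> exact norm_le_pi_norm w _

variable {a : ℂ}

theorem rho_pos (ha : ‖a‖ < 1) : 0 < rho a :=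
  Real.sqrt_pos.2 (by nlinarith [norm_nonneg a])

theorem rho_sq (ha : ‖a‖ < 1) : rho a ^ 2 = 1 - ‖a‖ ^ 2 :=
  Real.sq_sqrt (by nlinarith [norm_nonneg a])

theorem rho_le_one (a : ℂ) : rho a ≤ 1 :=
  Real.sqrt_le_one.2 (by linarith [sq_nonneg ‖a‖])

theorem rho_neg (a : ℂ) : rho (-a) = rho a := by simp [rho]

theorem ofReal_rho_ne_zero (ha : ‖a‖ < 1) : ((rho a : ℝ) : ℂ) ≠ 0 :=
  ofReal_ne_zero.2 (rho_pos ha).ne'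

theorem ofReal_rho_sq (ha : ‖a‖ < 1) :
    ((rho a : ℝ) : ℂ) ^ 2 = 1 - a * (starRingEnd ℂ) a := by
  rw [Complex.mul_conj, Complex.normSq_eq_norm_sq, ← ofReal_pow, rho_sq ha]
  push_cast
  ring

theorem T0m_mul_T0m_neg (ha : ‖a‖ < 1) (t : ℝ) : T0m a t * T0m (-a) (-t) = 1 := by
  have h0 := ofReal_rho_ne_zero ha
  have h2 := ofReal_rho_sq ha
  have he : cexp (I * t) * cexp (-(I * t)) = 1 := by rw [← Complex.exp_add]; simp
  ext i j
  fin_cases i <;> fin_cases j <;>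
    simp [T0m, rho_neg, Matrix.mul_apply, Fin.sum_univ_two] <;> field_simp <;>
    first | ring1 | linear_combination he - h2

theorem T0m_mul_self (ha : ‖a‖ < 1) {t ξ : ℝ} (ht : Real.cos t = rho a * Real.cos ξ) :
    T0m a t * T0m a t = ((2 * Real.cos ξ : ℝ) : ℂ) • T0m a t - 1 := by
  have h0 := ofReal_rho_ne_zero ha
  have h2 := ofReal_rho_sq ha
  have he : cexp (I * t) * cexp (-(I * t)) = 1 := by rw [← Complex.exp_add]; simp
  have hc : cexp (I * t) + cexp (-(I * t)) = 2 * (rho a * Complex.cos ξ) := by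
    rw [← ofReal_cos ξ, ← ofReal_mul, ← ht, ofReal_cos, Complex.two_cos]
    ring_nf
  ext i j
  fin_cases i <;> fin_cases j <;>
    simp [T0m, Matrix.mul_apply, Fin.sum_univ_two] <;> field_simp
  · linear_combination cexp (I * t) * hc - he + h2
  · linear_combination a * hc
  · linear_combination (starRingEnd ℂ) a * hc
  · linear_combination cexp (-(I * t)) * hc - he + h2

theorem pow_eq_one_add_geom_sum_smul {D : Matrix (Fin 2) (Fin 2) ℂ} {q : ℂ}
    (hD : D * D = (1 + q) • D - q • 1) (j : ℕ) :
    D ^ j = 1 + (∑ k ∈ Finset.range j, q ^ k) • (D - 1) := by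
  induction j with
  | zero => simp
  | succ j ih =>
    have h1 : (D - 1) * D = q • (D - 1) := by
      rw [sub_mul, one_mul, hD]
      module
    rw [pow_succ, ih, add_mul, one_mul, smul_mul_assoc, h1, geom_sum_succ]
    module

/-- The matrix `e^{iξ} T₀`, whose eigenvalues are `1` and `e^{2iξ}` when `cos t = ρ cos ξ`. -/
def twistedT0m (a : ℂ) (t ξ : ℝ) : Matrix (Fin 2) (Fin 2) ℂ := cexp (ξ * I) • T0m a t

theorem twistedT0m_mul_self (ha : ‖a‖ < 1) {t ξ : ℝ} (ht : Real.cos t = rho a * Real.cos ξ) :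
    twistedT0m a t ξ * twistedT0m a t ξ
      = (1 + cexp (ξ * I) ^ 2) • twistedT0m a t ξ - cexp (ξ * I) ^ 2 • 1 := by
  have hc : cexp (ξ * I) * ((2 * Real.cos ξ : ℝ) : ℂ) = 1 + cexp (ξ * I) ^ 2 := by
    push_cast
    have he : cexp (ξ * I) * cexp (-ξ * I) = 1 := by rw [← Complex.exp_add]; simp
    rw [Complex.two_cos]
    linear_combination he
  rw [← hc, twistedT0m, smul_mul_smul_comm, T0m_mul_self ha ht]
  module

theorem norm_T0m_apply_le (ha : ‖a‖ < 1) (t : ℝ) (i j : Fin 2) : ‖T0m a t i j‖ ≤ (rho a)⁻¹ := by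
  have h := inv_nonneg.2 (rho_pos ha).le
  have h1 : ‖cexp (-(I * t))‖ = 1 := by
    simpa using norm_exp_I_mul_ofReal (-t)
  fin_cases i <;> fin_cases j <;>
    simp [T0m, norm_exp_I_mul_ofReal, h1, abs_of_pos (rho_pos ha)] <;>
    exact mul_le_of_le_one_right h ha.le

theorem norm_twistedT0m_pow_mulVec_le (ha : ‖a‖ < 1) {t ξ R : ℝ}
    (ht : Real.cos t = rho a * Real.cos ξ) (hR : (rho a)⁻¹ ≤ R) (j : ℕ) (w : Fin 2 → ℂ) :
    ‖twistedT0m a t ξ ^ j *ᵥ w‖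
      ≤ (1 + 2 * (R + 1) * ‖∑ k ∈ Finset.range j, (cexp (ξ * I) ^ 2) ^ k‖) * ‖w‖ := by
  rw [pow_eq_one_add_geom_sum_smul (twistedT0m_mul_self ha ht), Matrix.add_mulVec,
    Matrix.one_mulVec, Matrix.smul_mulVec, add_mul, one_mul]
  refine (norm_add_le _ _).trans ?_
  rw [norm_smul]
  have : ‖(twistedT0m a t ξ - 1) *ᵥ w‖ ≤ 2 * (R + 1) * ‖w‖ := by
    refine norm_mulVec_le_of_entry_le (fun i j => ?_) w
    refine (norm_sub_le _ _).trans (add_le_add ?_ ?_)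
    · simpa [twistedT0m, Complex.norm_exp_ofReal_mul_I] using (norm_T0m_apply_le ha t i j).trans hR
    · by_cases h : i = j <;> simp [Matrix.one_apply, h]
  nlinarith [mul_le_mul_of_nonneg_left this
    (norm_nonneg (∑ k ∈ Finset.range j, (cexp (ξ * I) ^ 2) ^ k))]

theorem norm_geom_sum_le_natCast (ξ : ℝ) (j : ℕ) :
    ‖∑ k ∈ Finset.range j, (cexp (ξ * I) ^ 2) ^ k‖ ≤ j := by
  refine (norm_sum_le _ _).trans ?_
  simp [Complex.norm_exp_ofReal_mul_I]

theorem norm_geom_sum_le_inv_abs_sin {ξ : ℝ} (hξ : Real.sin ξ ≠ 0) (j : ℕ) :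
    ‖∑ k ∈ Finset.range j, (cexp (ξ * I) ^ 2) ^ k‖ ≤ |Real.sin ξ|⁻¹ := by
  have hz : ‖cexp (ξ * I)‖ = 1 := Complex.norm_exp_ofReal_mul_I ξ
  have hq : ‖cexp (ξ * I) ^ 2 - 1‖ = 2 * |Real.sin ξ| := by
    have : cexp (ξ * I) ^ 2 - 1 = cexp (ξ * I) * (2 * I * (Real.sin ξ : ℝ)) := by
      have he : cexp (ξ * I) * cexp (-ξ * I) = 1 := by rw [← Complex.exp_add]; simp
      rw [ofReal_sin, mul_right_comm, Complex.two_sin]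
      linear_combination (cexp (ξ * I) ^ 2 - cexp (ξ * I) * cexp (-ξ * I)) * I_mul_I + he
    rw [this]
    simp only [norm_mul, hz, norm_I, norm_real, Real.norm_eq_abs]
    norm_num
  have h := congrArg norm (geom_sum_mul (cexp (ξ * I) ^ 2) j)
  rw [norm_mul, hq] at h
  have h2 : ‖(cexp (ξ * I) ^ 2) ^ j - 1‖ ≤ 2 := by
    refine (norm_sub_le _ _).trans ?_
    simp [hz]
    norm_num
  rw [← one_div, le_div_iff₀ (abs_pos.2 hξ)]
  linarith

theorem abs_inv_rho_sub_inv_rho_le {a b : ℂ} {R : ℝ} (ha : ‖a‖ < 1) (hb : ‖b‖ < 1)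
    (hRa : (rho a)⁻¹ ≤ R) (hRb : (rho b)⁻¹ ≤ R) :
    |(rho a)⁻¹ - (rho b)⁻¹| ≤ 2 * R ^ 3 * ‖a - b‖ := by
  have pa := rho_pos ha
  have pb := rho_pos hb
  have hsum : (rho a + rho b)⁻¹ ≤ R := (inv_anti₀ pa (by linarith)).trans hRa
  have key : (rho a)⁻¹ - (rho b)⁻¹
      = (rho a)⁻¹ * (rho b)⁻¹ * (rho a + rho b)⁻¹ * ((‖a‖ + ‖b‖) * (‖a‖ - ‖b‖)) := by
    field_simp
    nlinarith [rho_sq ha, rho_sq hb]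
  have hR : 0 ≤ R := (inv_pos.2 pa).le.trans hRa
  rw [key, abs_mul, abs_mul (‖a‖ + ‖b‖), abs_of_pos (by positivity),
    abs_of_nonneg (by positivity : 0 ≤ ‖a‖ + ‖b‖)]
  calc _ ≤ R * R * R * (2 * ‖a - b‖) := by
        gcongr
        · linarith
        · exact abs_norm_sub_norm_le a b
    _ = _ := by ring

theorem norm_inv_rho_mul_sub_le {a b z w : ℂ} {R : ℝ} (ha : ‖a‖ < 1) (hb : ‖b‖ < 1)
    (hRa : (rho a)⁻¹ ≤ R) (hRb : (rho b)⁻¹ ≤ R) (hz : ‖z‖ ≤ 1) :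
    ‖((rho a : ℝ) : ℂ)⁻¹ * z - ((rho b : ℝ) : ℂ)⁻¹ * w‖ ≤ 2 * R ^ 3 * ‖a - b‖ + R * ‖z - w‖ := by
  rw [show ((rho a : ℝ) : ℂ)⁻¹ * z - ((rho b : ℝ) : ℂ)⁻¹ * w
    = (((rho a)⁻¹ - (rho b)⁻¹ : ℝ) : ℂ) * z + (((rho b)⁻¹ : ℝ) : ℂ) * (z - w) by
      push_cast; ring]
  refine (norm_add_le _ _).trans (add_le_add ?_ ?_)
  · rw [norm_mul, norm_real, Real.norm_eq_abs]
    exact (mul_le_of_le_one_right (abs_nonneg _) hz).trans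
      (abs_inv_rho_sub_inv_rho_le ha hb hRa hRb)
  · rw [norm_mul, norm_real, Real.norm_eq_abs, abs_of_pos (inv_pos.2 (rho_pos hb))]
    gcongr

theorem norm_exp_I_mul_sub_exp_I_mul_le (s t : ℝ) : ‖cexp (I * s) - cexp (I * t)‖ ≤ |s - t| := by
  have : cexp (I * s) - cexp (I * t) = cexp (I * t) * (cexp (I * (s - t : ℝ)) - 1) := by
    rw [mul_sub, ← Complex.exp_add]
    push_cast
    ring_nf
  rw [this, norm_mul, norm_exp_I_mul_ofReal, one_mul]
  exact Real.norm_exp_I_mul_ofReal_sub_one_le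

theorem norm_twistedT0m_sub_mulVec_le {a b : ℂ} {R : ℝ} (ha : ‖a‖ < 1) (hb : ‖b‖ < 1)
    (hRa : (rho a)⁻¹ ≤ R) (hRb : (rho b)⁻¹ ≤ R) (s t ξ : ℝ) (w : Fin 2 → ℂ) :
    ‖(twistedT0m a s ξ - twistedT0m b t ξ) *ᵥ w‖
      ≤ 2 * ((2 * R ^ 3 + R) * (‖a - b‖ + |s - t|)) * ‖w‖ := by
  have hR : 0 ≤ R := (inv_pos.2 (rho_pos ha)).le.trans hRa
  refine norm_mulVec_le_of_entry_le (fun i j => ?_) w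
  have hst := norm_exp_I_mul_sub_exp_I_mul_le s t
  have hst' : ‖cexp (-(I * s)) - cexp (-(I * t))‖ ≤ |s - t| := by
    have := norm_exp_I_mul_sub_exp_I_mul_le (-s) (-t)
    rwa [show -s - -t = -(s - t) by ring, abs_neg, ofReal_neg, ofReal_neg, mul_neg, mul_neg]
      at this
  have hs' : ‖cexp (-(I * s))‖ = 1 := by simpa using norm_exp_I_mul_ofReal (-s)
  rw [twistedT0m, twistedT0m, ← smul_sub, Matrix.smul_apply, norm_smul,
    Complex.norm_exp_ofReal_mul_I, one_mul]
  have main : ∀ z w : ℂ, ‖z‖ ≤ 1 → ‖z - w‖ ≤ ‖a - b‖ + |s - t| →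
      ‖((rho a : ℝ) : ℂ)⁻¹ * z - ((rho b : ℝ) : ℂ)⁻¹ * w‖
        ≤ (2 * R ^ 3 + R) * (‖a - b‖ + |s - t|) := fun z w hz hzw => by
    refine (norm_inv_rho_mul_sub_le ha hb hRa hRb hz).trans ?_
    rw [add_mul]
    gcongr
    linarith [abs_nonneg (s - t)]
  have hn := norm_nonneg (a - b)
  have hn' := abs_nonneg (s - t)
  fin_cases i <;> fin_cases j <;> simp only [T0m, Matrix.sub_apply, Matrix.smul_apply] <;>
    refine main _ _ ?_ ?_ <;> simp [norm_exp_I_mul_ofReal, hs', ha.le, hn', ← map_sub] <;> linarith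

end transfer

section Jost

theorem Aco_pos {a₀ : ℂ} (h₀ : 0 < ‖a₀‖) (ε ξ : ℝ) : 0 < Aco a₀ ε ξ := by
  unfold Aco
  positivity

theorem norm_jvec_le_one {a₀ : ℂ} (h₀ : 0 < ‖a₀‖) (ε ξ : ℝ) : ‖jvec a₀ ε ξ‖ ≤ 1 := by
  have hA := Real.sqrt_pos.2 (Aco_pos h₀ ε ξ)
  rw [jvec, norm_smul, norm_real, Real.norm_eq_abs, abs_of_pos (inv_pos.2 hA),
    inv_mul_le_iff₀ hA, mul_one]
  refine (pi_norm_le_iff_of_nonneg hA.le).2 fun i => Real.le_sqrt_of_sq_le ?_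
  fin_cases i <;> simp [Aco]

theorem cos_lamOf (a₀ : ℂ) (ξ : ℝ) : Real.cos (lamOf a₀ ξ) = rho a₀ * Real.cos ξ := by
  have h : |rho a₀ * Real.cos ξ| ≤ 1 := by
    rw [abs_mul, abs_of_nonneg (show 0 ≤ rho a₀ from Real.sqrt_nonneg _)]
    exact mul_le_one₀ (rho_le_one a₀) (abs_nonneg _) (Real.abs_cos_le_one ξ)
  exact Real.cos_arccos (abs_le.1 h).1 (abs_le.1 h).2

theorem T0m_mulVec_jvec {a₀ : ℂ} (h₁ : ‖a₀‖ < 1) {ε ξ : ℝ}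
    (hε : Real.cos (ε * ξ) = Real.cos ξ) :
    T0m a₀ (lamOf a₀ ξ) *ᵥ jvec a₀ ε ξ = cexp ((ε * ξ : ℝ) * I) • jvec a₀ ε ξ := by
  have h0 := ofReal_rho_ne_zero h₁
  have h2 := ofReal_rho_sq h₁
  have he : cexp (I * lamOf a₀ ξ) * cexp (-(I * lamOf a₀ ξ)) = 1 := by
    rw [← Complex.exp_add]; simp
  have hc : cexp (I * lamOf a₀ ξ) + cexp (-(I * lamOf a₀ ξ))
      = 2 * (rho a₀ * Complex.cos (ε * ξ : ℝ)) := by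
    rw [← ofReal_cos (ε * ξ), hε, ← ofReal_mul, ← cos_lamOf, ofReal_cos, Complex.two_cos]
    ring_nf
  have hz : cexp ((ε * ξ : ℝ) * I) * (2 * Complex.cos (ε * ξ : ℝ))
      = 1 + cexp ((ε * ξ : ℝ) * I) ^ 2 := by
    have he : cexp ((ε * ξ : ℝ) * I) * cexp (-(ε * ξ : ℝ) * I) = 1 := by
      rw [← Complex.exp_add]; simp
    rw [Complex.two_cos]
    linear_combination he
  rw [jvec, Matrix.mulVec_smul, smul_comm]
  congr 1
  generalize cexp ((ε * ξ : ℝ) * I) = z at *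
  generalize Complex.cos (ε * ξ : ℝ) = c at *
  ext i
  fin_cases i <;> simp [T0m, Matrix.mulVec, dotProduct, Fin.sum_univ_two] <;> field_simp
  · ring
  · linear_combination he - h2 - rho a₀ * z * hc - rho a₀ ^ 2 * hz

theorem twistedT0m_mulVec_jvec_neg_one {a₀ : ℂ} (h₁ : ‖a₀‖ < 1) (ξ : ℝ) :
    twistedT0m a₀ (lamOf a₀ ξ) ξ *ᵥ jvec a₀ (-1) ξ = jvec a₀ (-1) ξ := by
  rw [twistedT0m, Matrix.smul_mulVec, T0m_mulVec_jvec h₁ (by simp), smul_smul,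
    ← Complex.exp_add]
  simp

theorem twistedT0m_mulVec_jvec_one {a₀ : ℂ} (h₁ : ‖a₀‖ < 1) (ξ : ℝ) :
    twistedT0m (-a₀) (-lamOf a₀ ξ) ξ *ᵥ jvec a₀ 1 ξ = jvec a₀ 1 ξ := by
  have h := congrArg (T0m (-a₀) (-lamOf a₀ ξ) *ᵥ ·)
    (T0m_mulVec_jvec h₁ (show Real.cos (1 * ξ) = Real.cos ξ by simp))
  have hinv := T0m_mul_T0m_neg (a := -a₀) (by simpa using h₁) (-lamOf a₀ ξ)
  simp only [neg_neg] at hinv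
  simp only [Matrix.mulVec_mulVec, hinv, Matrix.one_mulVec, Matrix.mulVec_smul, one_mul] at h
  rw [twistedT0m, Matrix.smul_mulVec, ← h]

theorem Tmat_ofReal (α : ℤ → ℂ) (θ : ℤ → ℝ) (t : ℝ) (x : ℤ) :
    Tmat α θ t x = T0m (α x) (t - θ x) := by
  simp [Tmat, T0m]

theorem isJostP_of_backward {α : ℤ → ℂ} {θ : ℤ → ℝ} {a₀ : ℂ} {ξ : ℝ} {v : ℤ → Fin 2 → ℂ}
    (hα : ∀ x, ‖α x‖ < 1)
    (hv : ∀ x, v x = twistedT0m (-α x) (-lamOf a₀ ξ + θ x) ξ *ᵥ v (x + 1))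
    (hlim : Tendsto v atTop (𝓝 (jvec a₀ 1 ξ))) :
    IsJostP α θ a₀ ξ fun x => cexp ((ξ * x : ℝ) * I) • v x := by
  refine ⟨fun x => ?_, hlim.congr fun x => ?_⟩
  · have hinv := T0m_mul_T0m_neg (hα x) (lamOf a₀ ξ - θ x)
    rw [show -(lamOf a₀ ξ - θ x) = -lamOf a₀ ξ + θ x by ring] at hinv
    beta_reduce
    rw [Tmat_ofReal, hv x, twistedT0m, Matrix.mulVec_smul, Matrix.smul_mulVec, Matrix.mulVec_smul,
      Matrix.mulVec_mulVec, hinv, Matrix.one_mulVec, smul_smul, ← Complex.exp_add]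
    congr 2
    push_cast
    ring
  · ext i
    simp [← mul_assoc, ← Complex.exp_add]

theorem isJostM_of_backward {α : ℤ → ℂ} {θ : ℤ → ℝ} {a₀ : ℂ} {ξ : ℝ} {v : ℤ → Fin 2 → ℂ}
    (hv : ∀ x, v x = twistedT0m (α (-x - 1)) (lamOf a₀ ξ - θ (-x - 1)) ξ *ᵥ v (x + 1))
    (hlim : Tendsto v atTop (𝓝 (jvec a₀ (-1) ξ))) :
    IsJostM α θ a₀ ξ fun x => cexp (-((ξ * x : ℝ) * I)) • v (-x) := by
  refine ⟨fun x => ?_, (hlim.comp tendsto_neg_atBot_atTop).congr fun x => ?_⟩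
  · beta_reduce
    rw [hv (-(x + 1)), Tmat_ofReal, show -(-(x + 1)) - 1 = x by ring,
      show -(x + 1) + 1 = -x by ring, twistedT0m, Matrix.mulVec_smul, Matrix.smul_mulVec,
      smul_smul, ← Complex.exp_add]
    congr 2
    push_cast
    ring
  · ext i
    simp [← mul_assoc, ← Complex.exp_add]

theorem norm_twistedT0m_pow_mulVec_sub_mul_le {a b : ℂ} {R s t ξ m m' κ : ℝ} {j : ℕ}
    (ha : ‖a‖ < 1) (hb : ‖b‖ < 1) (hRa : (rho a)⁻¹ ≤ R) (hRb : (rho b)⁻¹ ≤ R)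
    (ht : Real.cos t = rho b * Real.cos ξ) (hm' : 0 ≤ m')
    (h : (1 + 2 * (R + 1) * ‖∑ k ∈ Finset.range j, (cexp (ξ * I) ^ 2) ^ k‖) * m' ≤ m * κ)
    (w : Fin 2 → ℂ) :
    ‖twistedT0m b t ξ ^ j *ᵥ ((twistedT0m a s ξ - twistedT0m b t ξ) *ᵥ w)‖ * m'
      ≤ m * (2 * (2 * R ^ 3 + R) * (κ * (‖a - b‖ + |s - t|))) * ‖w‖ := by
  have hR0 : 0 ≤ R := (inv_pos.2 (rho_pos ha)).le.trans hRa
  have hP := norm_twistedT0m_pow_mulVec_le hb ht hRb j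
    ((twistedT0m a s ξ - twistedT0m b t ξ) *ᵥ w)
  have hB := norm_twistedT0m_sub_mulVec_le ha hb hRa hRb s t ξ w
  have hS := norm_nonneg (∑ k ∈ Finset.range j, (cexp (ξ * I) ^ 2) ^ k)
  generalize ‖∑ k ∈ Finset.range j, (cexp (ξ * I) ^ 2) ^ k‖ = S at hP h hS
  calc _ ≤ ((1 + 2 * (R + 1) * S) * (2 * ((2 * R ^ 3 + R) * (‖a - b‖ + |s - t|)) * ‖w‖)) * m' := by
        gcongr
        exact hP.trans (by gcongr)
    _ = ((1 + 2 * (R + 1) * S) * m') * (2 * ((2 * R ^ 3 + R) * (‖a - b‖ + |s - t|)) * ‖w‖) := by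
        ring
    _ ≤ (m * κ) * (2 * ((2 * R ^ 3 + R) * (‖a - b‖ + |s - t|)) * ‖w‖) := by gcongr
    _ = _ := by ring

theorem exists_backward_twistedT0m {a₀ : ℂ} (h₁ : ‖a₀‖ < 1) {a : ℤ → ℂ} {s d m κ : ℤ → ℝ}
    {t ξ R : ℝ} {v₀ : Fin 2 → ℂ} (ha : ∀ x, ‖a x‖ < 1) (hd : ∀ x, ‖a x - a₀‖ + |s x - t| = d x)
    (hR₀ : (rho a₀)⁻¹ ≤ R) (hR : ∀ x, (rho (a x))⁻¹ ≤ R)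
    (ht : Real.cos t = rho a₀ * Real.cos ξ) (hv₀ : twistedT0m a₀ t ξ *ᵥ v₀ = v₀) (hv₁ : ‖v₀‖ ≤ 1)
    (hm : ∀ x, 1 ≤ m x) (hm1 : ∀ x, 0 ≤ x → m x = 1) (hκ : ∀ x, 0 ≤ κ x)
    (hκd : Summable fun x => κ x * d x)
    (h : ∀ (x : ℤ) (j : ℕ), (1 + 2 * (R + 1) * ‖∑ k ∈ Finset.range j, (cexp (ξ * I) ^ 2) ^ k‖)
      * m (x + j + 1) ≤ m x * κ (x + j)) :
    ∃ v : ℤ → Fin 2 → ℂ, (∀ x, v x = twistedT0m (a x) (s x) ξ *ᵥ v (x + 1)) ∧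
      Tendsto v atTop (𝓝 v₀) ∧
      ∀ x, ‖v x‖ ≤ Real.exp (2 * (2 * R ^ 3 + R) * ∑' y, κ y * d y) * m x := by
  have hR0 : 0 ≤ R := (inv_pos.2 (rho_pos h₁)).le.trans hR₀
  have hd0 : ∀ x, 0 ≤ d x := fun x => by rw [← hd]; positivity
  have hγ : ∀ x, 0 ≤ 2 * (2 * R ^ 3 + R) * (κ x * d x) := fun x =>
    mul_nonneg (by positivity) (mul_nonneg (hκ x) (hd0 x))
  have hpert : ∀ (x : ℤ) (j : ℕ) (w : Fin 2 → ℂ), ‖twistedT0m a₀ t ξ ^ j *ᵥ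
      ((twistedT0m (a (x + j)) (s (x + j)) ξ - twistedT0m a₀ t ξ) *ᵥ w)‖ * m (x + j + 1)
        ≤ m x * (2 * (2 * R ^ 3 + R) * (κ (x + j) * d (x + j))) * ‖w‖ := fun x j w => by
    rw [← hd]
    exact norm_twistedT0m_pow_mulVec_sub_mul_le (ha _) h₁ (hR _) hR₀ ht
      (zero_le_one.trans (hm _)) (h x j) w
  obtain ⟨v, hv, hlim, hb⟩ := exists_tendsto_of_backward_recursion
    (M := fun x => twistedT0m (a x) (s x) ξ) hv₀ hm hm1 hγ (hκd.mul_left _) hpert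
  refine ⟨v, hv, hlim, fun x => (hb x).trans ?_⟩
  rw [tsum_mul_left]
  have := zero_le_one.trans (hm x)
  gcongr
  exact mul_le_of_le_one_left (Real.exp_pos _).le hv₁

theorem nrm2_mul_le {z : ℂ} (hz : ‖z‖ = 1) (w : Fin 2 → ℂ) :
    nrm2 (fun i => z * w i) ≤ √2 * ‖w‖ := by
  have h := nrm2_le_sqrt_two_mul_norm (z • w)
  rwa [norm_smul, hz, one_mul] at h

/-- Jost solutions exist, with explicit bounds, as soon as the weight `κ`, which controls the
powers of the free matrix against the growth weight `m`, makes the perturbation summable. -/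
theorem exists_isJost {α₀ : ℂ} (h₀ : 0 < ‖α₀‖) (h₁ : ‖α₀‖ < 1) {α : ℤ → ℂ} {θ : ℤ → ℝ}
    (hα : ∀ x, ‖α x‖ < 1) {R ξ : ℝ} {m κ : ℤ → ℝ}
    (hR₀ : (rho α₀)⁻¹ ≤ R) (hR : ∀ x, (rho (α x))⁻¹ ≤ R)
    (hm : ∀ x, 1 ≤ m x) (hm1 : ∀ x, 0 ≤ x → m x = 1) (hκ : ∀ x, 0 ≤ κ x)
    (hκp : Summable fun x => κ x * (‖α x - α₀‖ + |θ x|))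
    (hκm : Summable fun x => κ x * (‖α (-x - 1) - α₀‖ + |θ (-x - 1)|))
    (h : ∀ (x : ℤ) (j : ℕ), (1 + 2 * (R + 1) * ‖∑ k ∈ Finset.range j, (cexp (ξ * I) ^ 2) ^ k‖)
      * m (x + j + 1) ≤ m x * κ (x + j)) :
    ∃ φp φm : ℤ → Fin 2 → ℂ, IsJostP α θ α₀ ξ φp ∧ IsJostM α θ α₀ ξ φm ∧
      (∀ x : ℤ, nrm2 (fun i => cexp (-((ξ * x : ℝ) * I)) * φp x i)
        ≤ √2 * Real.exp (2 * (2 * R ^ 3 + R) *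
          ∑' y, κ y * (‖α y - α₀‖ + |θ y|)) * m x) ∧
      (∀ x : ℤ, nrm2 (fun i => cexp ((ξ * x : ℝ) * I) * φm x i)
        ≤ √2 * Real.exp (2 * (2 * R ^ 3 + R) *
          ∑' y, κ y * (‖α (-y - 1) - α₀‖ + |θ (-y - 1)|)) * m (-x)) := by
  obtain ⟨v, hv, hvlim, hvb⟩ := exists_backward_twistedT0m (a₀ := -α₀) (a := fun x => -α x)
    (s := fun x => -lamOf α₀ ξ + θ x) (d := fun x => ‖α x - α₀‖ + |θ x|) (t := -lamOf α₀ ξ)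
    (by simpa using h₁) (by simpa using hα)
    (fun x => by rw [← norm_neg (α x - α₀)]; congr 2 <;> ring) (by simpa [rho_neg] using hR₀)
    (by simpa [rho_neg] using hR) (by rw [Real.cos_neg, rho_neg, cos_lamOf])
    (twistedT0m_mulVec_jvec_one h₁ ξ) (norm_jvec_le_one h₀ 1 ξ) hm hm1 hκ hκp h
  obtain ⟨w, hw, hwlim, hwb⟩ := exists_backward_twistedT0m (a₀ := α₀)
    (a := fun x => α (-x - 1)) (s := fun x => lamOf α₀ ξ - θ (-x - 1))
    (d := fun x => ‖α (-x - 1) - α₀‖ + |θ (-x - 1)|) (t := lamOf α₀ ξ) h₁ (fun x => hα _)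
    (fun x => by rw [← abs_neg (θ _)]; congr 2; ring) hR₀ (fun x => hR _)
    (cos_lamOf α₀ ξ) (twistedT0m_mulVec_jvec_neg_one h₁ ξ) (norm_jvec_le_one h₀ (-1) ξ)
    hm hm1 hκ hκm h
  refine ⟨_, _, isJostP_of_backward hα hv hvlim, isJostM_of_backward hw hwlim,
    fun x => ?_, fun x => ?_⟩
  · refine (nrm2_mul_le ?_ _).trans ?_
    · rw [← neg_mul, ← ofReal_neg, Complex.norm_exp_ofReal_mul_I]
    · rw [norm_smul, Complex.norm_exp_ofReal_mul_I, one_mul, mul_assoc]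
      gcongr
      exact hvb x
  · refine (nrm2_mul_le (Complex.norm_exp_ofReal_mul_I _) _).trans ?_
    rw [norm_smul, ← neg_mul, ← ofReal_neg, Complex.norm_exp_ofReal_mul_I, one_mul, mul_assoc]
    gcongr
    exact hwb (-x)

theorem exists_inv_rho_le {α₀ : ℂ} (h₁ : ‖α₀‖ < 1) {α : ℤ → ℂ}
    (hsum : Summable fun x => ‖α x - α₀‖) :
    ∃ R, (rho α₀)⁻¹ ≤ R ∧ ∀ x, (rho (α x))⁻¹ ≤ R := by
  have hlim : Tendsto α cofinite (𝓝 α₀) :=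
    tendsto_iff_norm_sub_tendsto_zero.2 hsum.tendsto_cofinite_zero
  have hcont : Continuous rho := by
    unfold rho
    fun_prop
  obtain ⟨R, hR⟩ := (((hcont.tendsto α₀).comp hlim).inv₀
    (rho_pos h₁).ne').bddAbove_range_of_cofinite
  exact ⟨max (rho α₀)⁻¹ R, le_max_left _ _, fun x =>
    (hR (Set.mem_range_self x)).trans (le_max_right _ _)⟩

theorem abs_add_two_le_jp (x : ℤ) : |(x : ℝ)| + 2 ≤ 3 * jp x := by
  have h : |(x : ℝ)| ≤ jp x := Real.abs_le_sqrt (by linarith)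
  have h' : 1 ≤ jp x := Real.one_le_sqrt.2 (by nlinarith)
  linarith

theorem natCast_add_one_mul_max_le (x : ℤ) (j : ℕ) :
    ((j : ℝ) + 1) * max 1 (-((x + j + 1 : ℤ) : ℝ)) ≤ max 1 (-(x : ℝ)) * (|((x + j : ℤ) : ℝ)| + 2) := by
  push_cast
  have hj : (0 : ℝ) ≤ j := Nat.cast_nonneg j
  rcases le_or_gt 0 (x + (j : ℤ)) with h | h
  · have h' : (0 : ℝ) ≤ x + j := by exact_mod_cast h
    rw [max_eq_left (by linarith), mul_one, abs_of_nonneg h']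
    rcases le_total 1 (-(x : ℝ)) with h1 | h1
    · rw [max_eq_right h1]
      nlinarith
    · rw [max_eq_left h1]
      by_cases hx : (0 : ℤ) ≤ x
      · have : (0 : ℝ) ≤ x := by exact_mod_cast hx
        linarith
      · linarith
  · have h' : (x : ℝ) + j ≤ -1 := by exact_mod_cast (by omega : x + (j : ℤ) ≤ -1)
    rw [abs_of_neg (by linarith), max_eq_right (by linarith : 1 ≤ -(x : ℝ))]
    gcongr
    · linarith
    · linarith
    · exact max_le (by linarith) (by linarith)

end Jost

/-- existence and bounds of Jost solutions. Under an `l¹` perturbation they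
exist for `sin ξ ≠ 0` with a bound `c(|sin ξ|⁻¹)` (`c` increasing, independent of `ξ`);
under an `l^{1,1}` perturbation they exist for all `ξ` with the bound `C·max(1, ∓x)`. -/
theorem stmt13 (α₀ : ℂ) (h₀ : 0 < ‖α₀‖) (h₁ : ‖α₀‖ < 1)
    (α : ℤ → ℂ) (θ : ℤ → ℝ) (hα : ∀ x : ℤ, ‖α x‖ < 1)
    (hsum : Summable fun x : ℤ => ‖α x - α₀‖ + |θ x|) :
    (∃ c : ℝ → ℝ, (∀ s : ℝ, 0 < s → 0 < c s) ∧
      (∀ s t : ℝ, 0 < s → s ≤ t → c s ≤ c t) ∧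
      ∀ ξ : ℝ, Real.sin ξ ≠ 0 →
        ∃ φp φm : ℤ → Fin 2 → ℂ, IsJostP α θ α₀ ξ φp ∧ IsJostM α θ α₀ ξ φm ∧
          (∀ x : ℤ,
            nrm2 (fun i => Complex.exp (-(((ξ * x : ℝ) : ℂ) * Complex.I)) * φp x i)
              ≤ c |Real.sin ξ|⁻¹) ∧
          (∀ x : ℤ,
            nrm2 (fun i => Complex.exp (((ξ * x : ℝ) : ℂ) * Complex.I) * φm x i)
              ≤ c |Real.sin ξ|⁻¹)) ∧
    ((Summable fun x : ℤ => jp x * (‖α x - α₀‖ + |θ x|)) →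
      ∃ C : ℝ, ∀ ξ : ℝ,
        ∃ φp φm : ℤ → Fin 2 → ℂ, IsJostP α θ α₀ ξ φp ∧ IsJostM α θ α₀ ξ φm ∧
          (∀ x : ℤ,
            nrm2 (fun i => Complex.exp (-(((ξ * x : ℝ) : ℂ) * Complex.I)) * φp x i)
              ≤ C * max 1 (-(x : ℝ))) ∧
          (∀ x : ℤ,
            nrm2 (fun i => Complex.exp (((ξ * x : ℝ) : ℂ) * Complex.I) * φm x i)
              ≤ C * max 1 (x : ℝ))) := by
  have hd0 : ∀ x, 0 ≤ ‖α x - α₀‖ + |θ x| := fun x => by positivity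
  obtain ⟨R, hR₀, hR⟩ := exists_inv_rho_le h₁ (hsum.of_nonneg_of_le (fun x => norm_nonneg _)
    fun x => le_add_of_nonneg_right (abs_nonneg (θ x)))
  have hR0 : 0 ≤ R := (inv_pos.2 (rho_pos h₁)).le.trans hR₀
  have hinj : Function.Injective fun x : ℤ => -x - 1 := fun x y h => by simpa using h
  refine ⟨⟨fun s => √2 * Real.exp (2 * (2 * R ^ 3 + R) * ((1 + 2 * (R + 1) * s) *
    ∑' y, (‖α y - α₀‖ + |θ y|))), fun s _ => by positivity, fun s t _ hst => ?_, fun ξ hξ => ?_⟩,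
    fun hjp => ?_⟩
  · have : 0 ≤ ∑' y, (‖α y - α₀‖ + |θ y|) := tsum_nonneg hd0
    beta_reduce
    gcongr
  · have hreflect : ∑' y, (‖α (-y - 1) - α₀‖ + |θ (-y - 1)|) = ∑' y, (‖α y - α₀‖ + |θ y|) :=
      ((Equiv.neg ℤ).trans (Equiv.subRight 1)).tsum_eq fun y => ‖α y - α₀‖ + |θ y|
    obtain ⟨φp, φm, hp, hm, hbp, hbm⟩ := exists_isJost (ξ := ξ) (m := fun _ => 1)
      (κ := fun _ => 1 + 2 * (R + 1) * |Real.sin ξ|⁻¹) h₀ h₁ hα hR₀ hR (fun _ => le_rfl)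
      (fun _ _ => rfl) (fun _ => by positivity) (hsum.mul_left _)
      ((hsum.comp_injective hinj).mul_left _) fun x j => by
        rw [mul_one, one_mul]
        gcongr
        exact norm_geom_sum_le_inv_abs_sin hξ j
    simp only [tsum_mul_left, hreflect, mul_one] at hbp hbm
    exact ⟨φp, φm, hp, hm, hbp, hbm⟩
  · have hw : Summable fun x : ℤ => (|(x : ℝ)| + 2) * (‖α x - α₀‖ + |θ x|) :=
      (hjp.mul_left 3).of_nonneg_of_le (fun x => mul_nonneg (by positivity) (hd0 x)) fun x => by
        rw [← mul_assoc]
        exact mul_le_mul_of_nonneg_right (abs_add_two_le_jp x) (hd0 x)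
    have hp : Summable fun x : ℤ =>
        (1 + 2 * (R + 1)) * (|(x : ℝ)| + 2) * (‖α x - α₀‖ + |θ x|) := by
      simpa only [mul_assoc] using hw.mul_left (1 + 2 * (R + 1))
    have hm : Summable fun x : ℤ =>
        (1 + 2 * (R + 1)) * (|(x : ℝ)| + 2) * (‖α (-x - 1) - α₀‖ + |θ (-x - 1)|) := by
      refine ((hp.comp_injective hinj).mul_left 2).of_nonneg_of_le
        (fun x => mul_nonneg (by positivity) (hd0 _)) fun x => ?_
      have hx : |(x : ℝ)| + 2 ≤ 2 * (|((-x - 1 : ℤ) : ℝ)| + 2) := by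
        push_cast
        cases abs_cases (x : ℝ) <;> cases abs_cases (-(x : ℝ) - 1) <;> linarith
      have hR1 : 0 ≤ 1 + 2 * (R + 1) := by positivity
      calc _ ≤ (1 + 2 * (R + 1)) * (2 * (|((-x - 1 : ℤ) : ℝ)| + 2))
            * (‖α (-x - 1) - α₀‖ + |θ (-x - 1)|) :=
            mul_le_mul_of_nonneg_right (mul_le_mul_of_nonneg_left hx hR1) (hd0 _)
        _ = _ := by
            simp only [Function.comp_apply]
            ring
    refine ⟨max
      (√2 * Real.exp (2 * (2 * R ^ 3 + R) *
        ∑' y : ℤ, (1 + 2 * (R + 1)) * (|(y : ℝ)| + 2) * (‖α y - α₀‖ + |θ y|)))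
      (√2 * Real.exp (2 * (2 * R ^ 3 + R) *
        ∑' y : ℤ, (1 + 2 * (R + 1)) * (|(y : ℝ)| + 2) *
          (‖α (-y - 1) - α₀‖ + |θ (-y - 1)|))), fun ξ => ?_⟩
    obtain ⟨φp, φm, hφp, hφm, hbp, hbm⟩ := exists_isJost (ξ := ξ) (m := fun x => max 1 (-(x : ℝ)))
      (κ := fun x => (1 + 2 * (R + 1)) * (|(x : ℝ)| + 2)) h₀ h₁ hα hR₀ hR
      (fun x => le_max_left _ _)
      (fun x hx => max_eq_left (by have : (0 : ℝ) ≤ x := by exact_mod_cast hx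
                                   linarith))
      (fun _ => by positivity) hp hm fun x j => by
        rw [mul_left_comm]
        refine le_trans ?_ (mul_le_mul_of_nonneg_left (natCast_add_one_mul_max_le x j)
          (by positivity))
        rw [← mul_assoc]
        gcongr
        have := norm_geom_sum_le_natCast ξ j
        nlinarith [mul_le_mul_of_nonneg_left this (by positivity : 0 ≤ 2 * (R + 1)),
          Nat.cast_nonneg (α := ℝ) j]
    refine ⟨φp, φm, hφp, hφm, fun x => (hbp x).trans ?_, fun x => (hbm x).trans ?_⟩
    · gcongr
      exact le_max_left _ _
    · simp only [Int.cast_neg, neg_neg]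
      gcongr
      exact le_max_right _ _
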